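/- For all real numbers t, r_i, r_j and all nonnegative real numbers ℓ_i, ℓ_j with r_i ≤ r_j, one has max(max(t, r_i) + ℓ_i, r_j) + ℓ_j ≤ max(max(t, r_j) + ℓ_j, r_i) + ℓ_i. (Interpretation: starting at time t, crossing the earlier-released of two platoons first, each crossing at the maximum of its release time and the previous finish time, yields a finish time no later than crossing them in the opposite order.) -/

import Mathlib

/-- Starting at time `t`, when two platoons with release times `ri ≤ rj` and
lengths `li, lj ≥ 0` cross an intersection sequentially — each crossing at the
maximum of its release time and the previous finish time — crossing the
earlier-released platoon first yields a finish time that is no later than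
crossing them in the opposite order. -/
theorem stmt5 (t ri rj li lj : ℝ) (hli : 0 ≤ li) (hlj : 0 ≤ lj) (hrij : ri ≤ rj) :
    max (max t ri + li) rj + lj ≤ max (max t rj + lj) ri + li := by
  have h1 : max t rj + lj ≤ max (max t rj + lj) ri := le_max_left _ _
  have h2 : max t ri ≤ max t rj := max_le_max le_rfl hrij
  have h3 : rj ≤ max t rj := le_max_right _ _
  have h4 : max (max t ri + li) rj ≤ max t rj + li :=
    max_le (by linarith) (by linarith)
  linarith
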